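/- Let G be a non-hamiltonian 1-tough graph on n ≥ 3 vertices with σ₃(G) ≥ n, let C be a longest cycle with a fixed orientation, u a vertex not on C, and v a vertex on C with both neighbors v⁺, v⁻ on C adjacent to u. Set B = N(u) ∪ N(v). Then B ⊆ V(C), and B ∩ B⁺ = ∅ and B ∩ B⁻ = ∅, where B⁺ (resp. B⁻) is the set of successors (resp. predecessors) along C of vertices in B. -/

import Mathlib

open scoped Classical

namespace Paper

noncomputable section

variable {V : Type*}

/-- degree as cardinality of neighbor set -/
def deg (G : SimpleGraph V) (x : V) : ℕ := (G.neighborSet x).ncard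

/-- G is 1-tough -/
def OneTough (G : SimpleGraph V) : Prop :=
  ∀ S : Set V, S.Nonempty → Nat.card ((G.induce Sᶜ).ConnectedComponent) ≤ S.ncard

def IsIndepTriple (G : SimpleGraph V) (s : Finset V) : Prop :=
  s.card = 3 ∧ ∀ x ∈ s, ∀ y ∈ s, x ≠ y → ¬ G.Adj x y

def sigma3 [Fintype V] (G : SimpleGraph V) : ℕ :=
  if ∃ s : Finset V, IsIndepTriple G s then
    sInf {k | ∃ s : Finset V, IsIndepTriple G s ∧ ∑ x ∈ s, deg G x = k}
  else 3 * (Fintype.card V - 1)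

def NC2 [Fintype V] (G : SimpleGraph V) : ℕ :=
  if G = ⊤ then Fintype.card V - 1
  else sInf {k | ∃ x y : V, G.dist x y = 2 ∧ (G.neighborSet x ∪ G.neighborSet y).ncard = k}

def circumference (G : SimpleGraph V) : ℕ :=
  sSup {k | ∃ (a : V) (w : G.Walk a a), w.IsCycle ∧ w.length = k}

def IsLongestCycle (G : SimpleGraph V) {a : V} (c : G.Walk a a) : Prop :=
  c.IsCycle ∧ ∀ (b : V) (w : G.Walk b b), w.IsCycle → w.length ≤ c.length

/-- successor of a vertex along the oriented cycle `c` (identity off the cycle) -/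
def cSucc [DecidableEq V] {G : SimpleGraph V} {a : V} (c : G.Walk a a) (x : V) : V :=
  if h : x ∈ c.support.tail then c.support.tail.next x h else x

/-- predecessor of a vertex along the oriented cycle `c` (identity off the cycle) -/
def cPred [DecidableEq V] {G : SimpleGraph V} {a : V} (c : G.Walk a a) (x : V) : V :=
  if h : x ∈ c.support.tail then c.support.tail.prev x h else x

/-- vertices strictly between `x` and `y` going forward along `c` -/
def arc [DecidableEq V] {G : SimpleGraph V} {a : V} (c : G.Walk a a) (x y : V) : Set V :=
  {z | ∃ i k : ℕ, 0 < i ∧ i < k ∧ k < c.length ∧ (cSucc c)^[k] x = y ∧ z = (cSucc c)^[i] x}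

/-- length of the interval of the cycle `c` starting at `b` determined by `B` -/
def intervalLen [DecidableEq V] {G : SimpleGraph V} {a : V} (c : G.Walk a a)
    (B : Set V) (b : V) : ℕ :=
  sInf {k | 0 < k ∧ (cSucc c)^[k] b ∈ B}

/-- inner vertices of the interval of the cycle `c` starting at `b` determined by `B` -/
def innerVerts [DecidableEq V] {G : SimpleGraph V} {a : V} (c : G.Walk a a)
    (B : Set V) (b : V) : Set V :=
  {x | ∃ i, 0 < i ∧ i < intervalLen c B b ∧ x = (cSucc c)^[i] b}

/-- the union of the neighborhoods of the vertices in `S` -/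
def nbhdSet (G : SimpleGraph V) (S : Set V) : Set V := {z | ∃ y ∈ S, G.Adj y z}

/-- a set of vertices is independent -/
def IsIndepSet (G : SimpleGraph V) (S : Set V) : Prop :=
  ∀ x ∈ S, ∀ y ∈ S, ¬ G.Adj x y

/-- `l` lists, in some order, the vertices visited by a walk from `x` to `y`. -/
def Spans (G : SimpleGraph V) (x y : V) (l : List V) : Prop :=
  ∃ p : G.Walk x y, p.support.Perm l

theorem Spans.single {G : SimpleGraph V} (x : V) : Spans G x x [x] :=
  ⟨SimpleGraph.Walk.nil, by simp⟩

theorem Spans.symm {G : SimpleGraph V} {x y : V} {l : List V} (h : Spans G x y l) :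
    Spans G y x l := by
  obtain ⟨p, hp⟩ := h
  exact ⟨p.reverse, by simpa using (List.reverse_perm _).trans hp⟩

theorem Spans.join {G : SimpleGraph V} {x y z w : V} {l m : List V} (h : Spans G x y l)
    (e : G.Adj y z) (h' : Spans G z w m) : Spans G x w (l ++ m) := by
  obtain ⟨p, hp⟩ := h
  obtain ⟨q, hq⟩ := h'
  refine ⟨p.append (SimpleGraph.Walk.cons e q), ?_⟩
  rw [SimpleGraph.Walk.support_append]
  exact hp.append (by simpa using hq)

theorem Spans.snoc {G : SimpleGraph V} {x y : V} {l : List V} (h : Spans G x y l)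
    {z : V} (e : G.Adj y z) : Spans G x z (l ++ [z]) :=
  h.join e (Spans.single z)

theorem spans_of_isChain {G : SimpleGraph V} {l : List V} {x y : V} (hl : l.IsChain G.Adj)
    (hx : l.head? = some x) (hy : l.getLast? = some y) : Spans G x y l := by
  have hne : l ≠ [] := by rintro rfl; simp at hx
  obtain rfl : l.head hne = x := by
    rw [List.head?_eq_some_head hne] at hx; simpa using hx
  obtain rfl : l.getLast hne = y := by
    rw [List.getLast?_eq_some_getLast hne] at hy; simpa using hy
  exact ⟨SimpleGraph.Walk.ofSupport l hne hl, by simp⟩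

/-- Every cycle of `G` has at most `m` vertices. -/
def CyclesLe (G : SimpleGraph V) (m : ℕ) : Prop :=
  ∀ x y l, Spans G x y l → G.Adj y x → l.Nodup → l.length ≤ m

theorem IsLongestCycle.cyclesLe {G : SimpleGraph V} {a : V} {c : G.Walk a a}
    (hc : IsLongestCycle G c) : CyclesLe G c.length := by
  rintro x y l ⟨p, hp⟩ e hl
  have h3 := hc.1.three_le_length
  have hlen : p.length + 1 = l.length := by rw [← hp.length_eq, p.length_support]
  have hpath : p.IsPath := (SimpleGraph.Walk.isPath_def p).2 (hp.nodup_iff.2 hl)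
  by_contra hlt
  have hcyc : (SimpleGraph.Walk.cons e p).IsCycle := by
    rw [SimpleGraph.Walk.cons_isCycle_iff]
    refine ⟨hpath, fun hmem => ?_⟩
    have := hpath.length_eq_one_of_mem_edges (Sym2.eq_swap ▸ hmem)
    omega
  have := hc.2 _ _ hcyc
  simp at this
  omega

theorem nodup_of_count_le {l m : List V} (hm : m.Nodup) (h : ∀ z, l.count z ≤ m.count z) :
    l.Nodup :=
  List.nodup_iff_count_le_one.2 fun z => (h z).trans (List.nodup_iff_count_le_one.1 hm z)

theorem spans_split {G : SimpleGraph V} {T X Y : List V} {r p a b : V} (hT : T.IsChain G.Adj)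
    (hr : T.head? = some r) (hp : T.getLast? = some p) (h : T = X ++ a :: b :: Y) :
    Spans G r a (X ++ [a]) ∧ Spans G b p (b :: Y) := by
  subst h
  have h' : X ++ a :: b :: Y = (X ++ [a]) ++ (b :: Y) := by simp
  rw [h'] at hT hr hp
  rw [List.isChain_append] at hT
  refine ⟨spans_of_isChain hT.1 ?_ (by simp), spans_of_isChain hT.2.1 (by simp) ?_⟩
  · cases X <;> simpa using hr
  · rwa [List.getLast?_append_of_ne_nil _ (by simp)] at hp

/-- Counting along a list: three predicates such that the sets where `P` holds, where `Q` holds at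
the next entry, and where `R` holds at the previous entry are disjoint. -/
theorem countP_add_countP_add_countP_le (P Q R : V → Prop) (l : List V) (x : V) (d : Prop)
    (hdP : d → ¬ P x) (hdQ : d → ∀ y Y, l = y :: Y → ¬ Q y)
    (hPQ : ∀ X a b Y, x :: l = X ++ a :: b :: Y → ¬ (P a ∧ Q b))
    (hRP : ∀ X a b Y, x :: l = X ++ a :: b :: Y → ¬ (R a ∧ P b))
    (hRQ : ∀ X a b c Y, x :: l = X ++ a :: b :: c :: Y → ¬ (R a ∧ Q c))
    (hR : ∀ X a, x :: l = X ++ [a] → ¬ R a) :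
    (if d then 1 else 0) + (x :: l).countP (P ·) + l.countP (Q ·) + (x :: l).countP (R ·)
      ≤ l.length + 1 := by
  induction l generalizing x d with
  | nil =>
    have := hR [] x rfl
    by_cases hd : d <;> by_cases hx : P x <;> simp_all
  | cons y l ih =>
    have key := ih y (R x) (fun h hP => hRP [] x y l rfl ⟨h, hP⟩)
      (fun h z Y hz hQ => hRQ [] x y z Y (by simp [hz]) ⟨h, hQ⟩)
      (fun X a b Y h => hPQ (x :: X) a b Y (by simp [h]))
      (fun X a b Y h => hRP (x :: X) a b Y (by simp [h]))
      (fun X a b c Y h => hRQ (x :: X) a b c Y (by simp [h]))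
      (fun X a h => hR (x :: X) a (by simp [h]))
    have h1 := hPQ [] x y l rfl
    have h2 : d → ¬ Q y := fun h => hdQ h y l rfl
    rw [List.countP_cons (l := y :: l) (a := x), List.countP_cons (l := l) (a := y) (p := (Q ·)),
      List.countP_cons (l := y :: l) (a := x)]
    have h3 : (if d then 1 else 0) + (if P x then 1 else 0) + (if Q y then 1 else 0) ≤ 1 := by
      split_ifs <;> first | omega | (exfalso; tauto)
    simp only [decide_eq_true_eq, List.length_cons]
    omega

theorem sigma3_le [Fintype V] {G : SimpleGraph V} {x y z : V} (hxy : x ≠ y) (hxz : x ≠ z)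
    (hyz : y ≠ z) (nxy : ¬ G.Adj x y) (nxz : ¬ G.Adj x z) (nyz : ¬ G.Adj y z) :
    sigma3 G ≤ deg G x + deg G y + deg G z := by
  have hI : IsIndepTriple G {x, y, z} := by
    refine ⟨Finset.card_eq_three.2 ⟨x, y, z, hxy, hxz, hyz, rfl⟩, ?_⟩
    have nyx := fun h => nxy (G.adj_symm h)
    have nzx := fun h => nxz (G.adj_symm h)
    have nzy := fun h => nyz (G.adj_symm h)
    simp only [Finset.mem_insert, Finset.mem_singleton]
    rintro s (rfl | rfl | rfl) t (rfl | rfl | rfl) hst <;> first | exact absurd rfl hst | assumption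
  rw [sigma3, if_pos ⟨_, hI⟩]
  refine Nat.sInf_le ⟨_, hI, ?_⟩
  rw [Finset.sum_insert (by simp [hxy, hxz]), Finset.sum_insert (by simp [hyz]),
    Finset.sum_singleton, add_assoc]

/-- The degree of `x`, split along a duplicate-free list and its complement. -/
theorem deg_eq_countP_add [Fintype V] (G : SimpleGraph V) (x : V) {l : List V} (hl : l.Nodup) :
    deg G x = l.countP (G.Adj x ·)
      + (Finset.univ.filter fun y => y ∉ l ∧ G.Adj x y).card := by
  have h1 : deg G x = (Finset.univ.filter fun y => G.Adj x y).card := by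
    rw [deg, ← Set.ncard_coe_finset]
    congr 1
    ext y
    simp
  have h2 : l.countP (G.Adj x ·) = (Finset.univ.filter fun y => y ∈ l ∧ G.Adj x y).card := by
    rw [List.countP_eq_length_filter, ← List.toFinset_card_of_nodup (hl.filter _)]
    congr 1
    ext y
    simp
  rw [h1, h2, ← Finset.card_union_of_disjoint]
  · congr 1
    ext y
    by_cases hy : y ∈ l <;> simp [hy]
  · rw [Finset.disjoint_filter]
    tauto

/-- Two vertices `u` and `v` both close up the path `q :: T` into a longest cycle. -/
structure Twins (G : SimpleGraph V) (u v q p : V) (T : List V) : Prop where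
  nodup : (u :: v :: q :: T).Nodup
  chain : (q :: T).IsChain G.Adj
  ne_nil : T ≠ []
  last : T.getLast? = some p
  uq : G.Adj u q
  up : G.Adj u p
  vq : G.Adj v q
  vp : G.Adj v p
  max : CyclesLe G (T.length + 2)

namespace Twins

variable {G : SimpleGraph V} {u v q p : V} {T : List V}

theorem swap (h : Twins G u v q p T) : Twins G v u q p T where
  nodup := (List.Perm.swap _ _ _).nodup_iff.2 h.nodup
  chain := h.chain
  ne_nil := h.ne_nil
  last := h.last
  uq := h.vq
  up := h.vp
  vq := h.uq
  vp := h.up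
  max := h.max

theorem spans (h : Twins G u v q p T) : Spans G q p (q :: T) :=
  spans_of_isChain h.chain (by simp) (by
    have := h.last
    rw [List.getLast?_cons, this]; rfl)

theorem not_adj (h : Twins G u v q p T) : ¬ G.Adj u v := by
  intro e
  have hs := h.spans
  have hn := h.nodup
  have := h.max _ _ _ (((Spans.single u).join e (Spans.single v)).join h.vq hs) h.up.symm
    (by simpa using hn)
  simp at this

theorem mem_of_adj_left [Fintype V] (h : Twins G u v q p T)
    (hsig : Fintype.card V ≤ sigma3 G) {w : V} (hw : G.Adj u w) : w ∈ q :: T := by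
  by_contra hwM
  obtain ⟨hnd, hch, hne, hlast, huq, hup, hvq, hvp, hmax⟩ := id h
  have huv := h.not_adj
  have hM := h.spans
  obtain ⟨r, hr⟩ : ∃ r, T.head? = some r := by
    cases T with
    | nil => exact absurd rfl hne
    | cons r T => exact ⟨r, rfl⟩
  have hTc : T.IsChain G.Adj := hch.of_cons
  have hT : Spans G r p T := spans_of_isChain hTc hr hlast
  have hrT : r ∈ T := List.mem_of_mem_head? hr
  have hpT : p ∈ T := List.mem_of_getLast? hlast
  have hqr : G.Adj q r := by
    rw [List.isChain_cons] at hch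
    exact hch.1 r hr
  have hwu : w ≠ u := hw.ne'
  have hwv : w ≠ v := by rintro rfl; exact huv hw
  have su := Spans.single (G := G) u
  have sv := Spans.single (G := G) v
  have sq := Spans.single (G := G) q
  have hwM' : w ≠ q ∧ w ∉ T := by simpa using hwM
  have hnd' := hnd
  simp only [List.nodup_cons, List.mem_cons, not_or] at hnd'
  obtain ⟨⟨huv', huq', huT⟩, ⟨hvq', hvT⟩, hqT, hTn⟩ := hnd'
  have hN : (w :: u :: v :: q :: T).Nodup :=
    List.nodup_cons.2 ⟨by simp [hwu, hwv, hwM'], hnd⟩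
  have hur : ¬ G.Adj u r := fun e => by
    have := hmax _ _ _ ((sq.snoc huq.symm).join e hT |>.snoc hvp.symm) hvq
          (nodup_of_count_le hN fun z => by
            simp only [List.count_append, List.count_cons, List.count_nil]; omega)
    simp at this
  have hvr : ¬ G.Adj v r := fun e => by
    have := hmax _ _ _ ((sv.join e hT).snoc hup.symm |>.snoc huq) hvq.symm
          (nodup_of_count_le hN fun z => by
            simp only [List.count_append, List.count_cons, List.count_nil]; omega)
    simp at this
  have hwv2 : ¬ G.Adj v w := fun e => by
    have := hmax _ _ _ (((hM.snoc hup.symm).snoc hw).snoc e.symm) hvq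
          (nodup_of_count_le hN fun z => by
            simp only [List.count_append, List.count_cons, List.count_nil]; omega)
    simp at this
  have hwq : ¬ G.Adj w q := fun e => by
    have := hmax _ _ _ ((hM.snoc hup.symm).snoc hw) e
          (nodup_of_count_le hN fun z => by
            simp only [List.count_append, List.count_cons, List.count_nil]; omega)
    simp at this
  have hwp : ¬ G.Adj w p := fun e => by
    have := hmax _ _ _ ((hM.symm.snoc huq.symm).snoc hw) e
          (nodup_of_count_le hN fun z => by
            simp only [List.count_append, List.count_cons, List.count_nil]; omega)
    simp at this
  have hrw : ¬ G.Adj r w := fun e => by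
    have := hmax _ _ _ ((((sq.snoc huq.symm).snoc hw).join e.symm hT).snoc hvp.symm) hvq
          (nodup_of_count_le hN fun z => by
            simp only [List.count_append, List.count_cons, List.count_nil]; omega)
    simp at this
  have hcount : T.countP (G.Adj v ·) + T.tail.countP (G.Adj r ·) + T.countP (G.Adj w ·)
      ≤ T.length := by
    obtain ⟨T', rfl⟩ : ∃ T', T = r :: T' := by
      cases T with
      | nil => exact absurd rfl hne
      | cons s T => simp at hr; exact ⟨T, by rw [hr]⟩
    have key := countP_add_countP_add_countP_le (G.Adj v) (G.Adj r) (G.Adj w) T' r False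
      False.elim False.elim ?_ ?_ ?_ ?_
    · simpa using key
    · rintro X a b Y hX ⟨e1, e2⟩
      obtain ⟨s1, s2⟩ := spans_split hTc hr hlast hX
      have hN := hX ▸ hN
      have hlen := congrArg List.length hX
      simp at hlen
      have := hmax _ _ _ ((((su.snoc huq).snoc hvq.symm).join e1 s1.symm).join e2 s2) hup.symm
          (nodup_of_count_le hN fun z => by
            simp only [List.count_append, List.count_cons, List.count_nil]; omega)
      simp at this; omega
    · rintro X a b Y hX ⟨e1, e2⟩
      obtain ⟨s1, s2⟩ := spans_split hTc hr hlast hX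
      have hN := hX ▸ hN
      have hlen := congrArg List.length hX
      simp at hlen
      have := hmax _ _ _ ((((((su.snoc hw).join e1 s1.symm).snoc hqr.symm).snoc hvq.symm)).join e2 s2)
        hup.symm
          (nodup_of_count_le hN fun z => by
            simp only [List.count_append, List.count_cons, List.count_nil]; omega)
      simp at this; omega
    · rintro X a b d Y hX ⟨e1, e2⟩
      obtain ⟨s1, -⟩ := spans_split hTc hr hlast hX
      obtain ⟨-, s2⟩ := spans_split (X := X ++ [a]) hTc hr hlast (by simpa using hX)
      have hN := hX ▸ hN
      have hlen := congrArg List.length hX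
      simp at hlen
      have := hmax _ _ _ (((((su.snoc hw).join e1 s1.symm).join e2 s2).snoc hvp.symm).snoc hvq)
        huq.symm
          (nodup_of_count_le hN fun z => by
            simp only [List.count_append, List.count_cons, List.count_nil]; omega)
      simp at this; omega
    · rintro X a hX
      have : a = p := by rw [hX] at hlast; simpa using hlast
      exact this ▸ hwp
  have hMn : (v :: q :: T).Nodup := (List.nodup_cons.1 hnd).2
  have hcr : T.countP (G.Adj r ·) = T.tail.countP (G.Adj r ·) := by
    cases T with
    | nil => rfl
    | cons s T => simp at hr; simp [hr]
  have dv := deg_eq_countP_add G v hMn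
  have dr := deg_eq_countP_add G r hMn
  have dw := deg_eq_countP_add G w hMn
  rw [List.countP_cons, List.countP_cons] at dv dr dw
  have hoff : (Finset.univ.filter fun y => y ∉ v :: q :: T ∧ G.Adj v y).card
      + (Finset.univ.filter fun y => y ∉ v :: q :: T ∧ G.Adj r y).card
      + (Finset.univ.filter fun y => y ∉ v :: q :: T ∧ G.Adj w y).card + 1
      + (v :: q :: T).length ≤ Fintype.card V := by
    rw [← List.toFinset_card_of_nodup hMn, ← Finset.card_singleton w,
      ← Finset.card_union_of_disjoint, ← Finset.card_union_of_disjoint,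
      ← Finset.card_union_of_disjoint, ← Finset.card_union_of_disjoint]
    · exact Finset.card_le_univ _
    · rw [Finset.disjoint_right]
      intro y hy
      rw [List.mem_toFinset] at hy
      simp only [Finset.mem_union, Finset.mem_filter, Finset.mem_singleton]
      rintro (((h | h) | h) | rfl)
      · exact h.2.1 hy
      · exact h.2.1 hy
      · exact h.2.1 hy
      · grind
    · simp [hwv2, hrw]
    · rw [Finset.disjoint_right]
      simp only [Finset.mem_union, Finset.mem_filter, Finset.mem_univ, true_and]
      rintro y ⟨hy, e⟩ (⟨-, e'⟩ | ⟨-, e'⟩)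
      · have : y ≠ u := by rintro rfl; exact huv e'.symm
        have hN := List.nodup_cons.2
          ⟨(by simp_all [e.ne'] : y ∉ w :: u :: v :: q :: T), hN⟩
        have := hmax _ _ _ ((((hM.snoc hup.symm).snoc hw).snoc e).snoc e'.symm) hvq
          (nodup_of_count_le hN fun z => by
            simp only [List.count_append, List.count_cons, List.count_nil]; omega)
        simp at this
      · have : y ≠ u := by rintro rfl; exact hur e'.symm
        have hN := List.nodup_cons.2
          ⟨(by simp_all [e.ne'] : y ∉ w :: u :: v :: q :: T), hN⟩
        have := hmax _ _ _ (((((sq.snoc huq.symm).snoc hw).snoc e).join e'.symm hT).snoc hvp.symm)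
          hvq
          (nodup_of_count_le hN fun z => by
            simp only [List.count_append, List.count_cons, List.count_nil]; omega)
        simp at this; omega
    · rw [Finset.disjoint_right]
      simp only [Finset.mem_filter, Finset.mem_univ, true_and]
      rintro y ⟨hy, e⟩ ⟨-, e'⟩
      have : y ≠ u := by rintro rfl; exact hur e.symm
      have hN := List.nodup_cons.2
        ⟨(by simp_all : y ∉ u :: v :: q :: T), hnd⟩
      have := hmax _ _ _ ((((sv.snoc e').join e.symm hT).snoc hup.symm).snoc huq) hvq.symm
          (nodup_of_count_le hN fun z => by
            simp only [List.count_append, List.count_cons, List.count_nil]; omega)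
      simp at this
  have hs := sigma3_le (G := G) (x := v) (y := r) (z := w) (by grind) hwv.symm (by grind)
    hvr hwv2 hrw
  have hrv : ¬ G.Adj r v := fun e => hvr e.symm
  have hwv3 : ¬ G.Adj w v := fun e => hwv2 e.symm
  simp only [SimpleGraph.irrefl, hvq, hrv, hwv3, hwq, hqr.symm, decide_true, decide_false,
    if_true, Bool.false_eq_true, if_false] at dv dr dw
  simp only [List.length_cons] at hoff
  omega

theorem not_adj_consecutive_left (h : Twins G u v q p T) {X Y : List V} {x y : V}
    (hX : q :: T = X ++ x :: y :: Y) (hx : G.Adj u x) : ¬ (G.Adj u y ∨ G.Adj v y) := by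
  obtain ⟨s1, s2⟩ := spans_split h.chain (List.head?_cons (a := q)) (by
    rw [List.getLast?_cons, h.last]) hX
  have hN := h.nodup
  have hl : T.length + 1 = X.length + Y.length + 2 := by
    have := congrArg List.length hX
    simp at this
    omega
  rw [hX] at hN
  rintro (e | e)
  · have := h.max _ _ _ (((s1.snoc hx.symm).join e s2).snoc h.vp.symm) h.vq
          (nodup_of_count_le hN fun z => by
            simp only [List.count_append, List.count_cons, List.count_nil]; omega)
    simp at this; omega
  · have := h.max _ _ _ ((((Spans.single u).join hx s1.symm).snoc h.vq.symm).join e s2)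
      h.up.symm
          (nodup_of_count_le hN fun z => by
            simp only [List.count_append, List.count_cons, List.count_nil]; omega)
    simp at this; omega

theorem not_adj_consecutive (h : Twins G u v q p T) {X Y : List V} {x y : V}
    (hX : q :: T = X ++ x :: y :: Y) (hx : G.Adj u x ∨ G.Adj v x) :
    ¬ (G.Adj u y ∨ G.Adj v y) := by
  rcases hx with hx | hx
  · exact h.not_adj_consecutive_left hX hx
  · exact fun e => h.swap.not_adj_consecutive_left hX hx e.symm

end Twins

theorem stmt4 {V : Type*} [Fintype V] [DecidableEq V] (G : SimpleGraph V)
    (hn : 3 ≤ Fintype.card V) (htough : OneTough G) (hsig : Fintype.card V ≤ sigma3 G)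
    (hham : ¬ G.IsHamiltonian) {a : V} (c : G.Walk a a) (hc : IsLongestCycle G c)
    (u v : V) (hu : u ∉ c.support) (hv : v ∈ c.support)
    (huv1 : G.Adj u (cSucc c v)) (huv2 : G.Adj u (cPred c v))
    (B : Set V) (hB : B = G.neighborSet u ∪ G.neighborSet v) :
    B ⊆ {x | x ∈ c.support} ∧ B ∩ (cSucc c '' B) = ∅ ∧ B ∩ (cPred c '' B) = ∅ := by
  have hLn : c.support.tail.Nodup := hc.1.support_nodup
  have hmemL : ∀ x, x ∈ c.support.tail ↔ x ∈ c.support := fun x =>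
    ⟨List.mem_of_mem_tail, fun hx => by
      rw [SimpleGraph.Walk.mem_support_iff] at hx
      rcases hx with rfl | hx
      · exact SimpleGraph.Walk.end_mem_tail_support hc.1.not_nil
      · exact hx⟩
  have hLlen : c.support.tail.length = c.length := by simp
  have h3 := hc.1.three_le_length
  have hcyc : Cycle.Chain G.Adj (c.support.tail : Cycle V) := by
    have hne : c.support.tail ≠ [] := by
      intro h; rw [h] at hLlen; simp at hLlen; omega
    have hlast : c.support.tail.getLast hne = a := by
      rw [List.getLast_tail]; simp
    have hch := c.isChain_adj_support
    rw [← SimpleGraph.Walk.cons_tail_support, ← List.dropLast_append_getLast hne, hlast] at hch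
    rw [← List.dropLast_append_getLast hne, hlast, ← Cycle.coe_cons_eq_coe_append,
      Cycle.chain_coe_cons]
    exact hch
  set L := c.support.tail with hL
  have hrot : ∀ x ∈ L, ∃ M, L ~r x :: M := by
    intro x hx
    obtain ⟨s, t, hst⟩ := List.append_of_mem hx
    exact ⟨t ++ s, by rw [hst]; exact List.isRotated_append (l := s) (l' := x :: t)⟩
  have hvL : v ∈ L := (hmemL v).2 hv
  obtain ⟨M, hM⟩ := hrot v hvL
  have hMlen : M.length + 1 = c.length := by
    rw [← hLlen, hM.perm.length_eq]; rfl
  have hMn : (v :: M).Nodup := hM.nodup_iff.1 hLn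
  rw [Cycle.coe_eq_coe.2 hM, Cycle.chain_coe_cons] at hcyc
  obtain ⟨q, T, rfl⟩ : ∃ q T, M = q :: T := by
    cases M with
    | nil => simp at hMlen; omega
    | cons q T => exact ⟨q, T, rfl⟩
  have hTne : T ≠ [] := by rintro rfl; simp at hMlen; omega
  obtain ⟨p, hp⟩ : ∃ p, T.getLast? = some p := ⟨_, List.getLast?_eq_some_getLast hTne⟩
  have hmem : ∀ x, x ∈ c.support ↔ x = v ∨ x ∈ q :: T := fun x => by
    rw [← hmemL, hM.mem_iff, List.mem_cons]
  have hsucc : cSucc c v = q := by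
    rw [cSucc, dif_pos hvL, List.isRotated_next_eq hM hLn, List.next_cons_cons_eq]
  have hpred : cPred c v = p := by
    have hvm : v ∈ v :: q :: T := by simp
    have : (v :: q :: T).prev v hvm = p := by
      rw [List.prev_getLast_cons]
      rw [List.getLast?_eq_some_getLast hTne] at hp
      simpa [hTne] using hp
    rw [cPred, dif_pos hvL, List.isRotated_prev_eq hM hLn, this]
  rw [hsucc] at huv1
  rw [hpred] at huv2
  have hch : (v :: (q :: T)).IsChain G.Adj ∧ G.Adj v p := by
    have h' : v :: (q :: T ++ [v]) = (v :: q :: T) ++ [v] := by simp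
    rw [h', List.isChain_append] at hcyc
    refine ⟨hcyc.1, (hcyc.2.2 p ?_ v (by simp)).symm⟩
    simp [List.getLast?_cons, hp]
  have huM : u ≠ v ∧ u ∉ q :: T := by
    rw [hmem] at hu
    tauto
  have htw : Twins G u v q p T := by
    refine ⟨List.nodup_cons.2 ⟨by simpa using huM, hMn⟩, hch.1.of_cons, hTne, hp, huv1, huv2,
      ?_, hch.2, ?_⟩
    · exact (List.isChain_cons_cons.1 hch.1).1
    · have := hc.cyclesLe
      rwa [← hMlen] at this
  have hBM : ∀ x ∈ B, x ∈ q :: T := by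
    rw [hB]
    rintro x (hx | hx)
    · exact htw.mem_of_adj_left hsig hx
    · exact htw.swap.mem_of_adj_left hsig hx
  have hBL : ∀ x ∈ B, x ∈ L := fun x hx => (hmemL x).2 ((hmem x).2 (Or.inr (hBM x hx)))
  have key : ∀ x ∈ B, cSucc c x ∉ B := by
    intro x hx hy
    have hxM := hBM x hx
    obtain ⟨X, R, hX⟩ := List.append_of_mem hxM
    have hrot' : L ~r x :: (R ++ v :: X) := by
      refine hM.trans ?_
      rw [hX]
      simpa using List.isRotated_append (l := v :: X) (l' := x :: R)
    have hyv : cSucc c x ≠ v := by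
      intro h
      have := hBM _ hy
      rw [h] at this
      exact (List.nodup_cons.1 hMn).1 this
    rw [cSucc, dif_pos (hBL x hx), List.isRotated_next_eq hrot' hLn] at hy hyv
    cases R with
    | nil => exact hyv (by simpa only [List.nil_append] using
        List.next_cons_cons_eq (l := X) (x := x) v (by simp))
    | cons y Y =>
      have hnext := List.next_cons_cons_eq (l := Y ++ v :: X) (x := x) y (by simp)
      simp only [List.cons_append] at hy
      rw [hnext] at hy
      rw [hB] at hx hy
      exact htw.not_adj_consecutive hX hx hy
  refine ⟨fun x hx => (hmem x).2 (Or.inr (hBM x hx)), ?_, ?_⟩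
  · rw [Set.eq_empty_iff_forall_notMem]
    rintro _ ⟨hy, x, hx, rfl⟩
    exact key x hx hy
  · rw [Set.eq_empty_iff_forall_notMem]
    rintro _ ⟨hy, x, hx, rfl⟩
    apply key _ hy
    have hxL := hBL x hx
    have : cSucc c (cPred c x) = x := by
      have hpL : cPred c x ∈ c.support.tail := hBL _ hy
      rw [cSucc, dif_pos hpL]
      have hp' : cPred c x = L.prev x hxL := dif_pos hxL
      simp only [hp']
      exact List.next_prev _ hLn _ _
    rwa [this]


end
end Paper
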